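/- Let N be a positive integer, 𝔄 = [𝔞₁,…,𝔞ₙ] a tuple of elements of 𝔈, F ∈ ℤ[X₁,…,Xₙ], and for each λ ∈ 𝔖_N fix M_λ ∈ Γ₀(N) congruent to diag(λ⁻¹, λ) mod N. Then for every τ in the upper half-plane, T_{𝔄,F}(τ) = Σ_{λ∈𝔖_N} F(W_{λ𝔞₁}(τ),…,W_{λ𝔞ₙ}(τ)); in particular T_{𝔄,F} does not depend on the choice of the matrices M_λ. -/

import Mathlib

open scoped MatrixGroups
open Complex

/-- The Weierstrass ℘-function of the lattice `L_τ = ℤ + ℤτ`. -/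
noncomputable def wp (τ z : ℂ) : ℂ :=
  1 / z ^ 2 + ∑' p : {p : ℤ × ℤ // p ≠ 0},
    (1 / (z - ((p.1.1 : ℂ) + (p.1.2 : ℂ) * τ)) ^ 2 - 1 / ((p.1.1 : ℂ) + (p.1.2 : ℂ) * τ) ^ 2)

/-- The function `W_𝔞` for the triple `𝔞 = [a₁,a₂,a₃]`. -/
noncomputable def Wfun (N : ℕ) (a₁ a₂ a₃ : ℤ) (τ : ℂ) : ℂ :=
  (wp τ ((a₁ : ℂ) / N) - wp τ ((a₃ : ℂ) / N)) / (wp τ ((a₂ : ℂ) / N) - wp τ ((a₃ : ℂ) / N))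

/-- Möbius action of an integral 2×2 matrix on ℂ. -/
noncomputable def moebius (A : Matrix (Fin 2) (Fin 2) ℤ) (τ : ℂ) : ℂ :=
  ((A 0 0 : ℂ) * τ + (A 0 1 : ℂ)) / ((A 1 0 : ℂ) * τ + (A 1 1 : ℂ))

/-- `𝔖_N = (ℤ/Nℤ)ˣ/{±1}`. -/
abbrev SNgroup (N : ℕ) := (ZMod N)ˣ ⧸ (Subgroup.closure ({-1} : Set (ZMod N)ˣ))

/-- The triple `𝔞 = [a₁,a₂,a₃]` is in `𝔈`. -/
def memE (N : ℕ) (a : ℤ × ℤ × ℤ) : Prop :=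
  0 < a.1 ∧ 0 < a.2.1 ∧ 0 < a.2.2 ∧ 2 * a.1 ≤ (N : ℤ) ∧ 2 * a.2.1 ≤ (N : ℤ) ∧
    2 * a.2.2 ≤ (N : ℤ) ∧ a.1 ≠ a.2.1 ∧ a.1 ≠ a.2.2 ∧ a.2.1 ≠ a.2.2

def memE1 (N : ℕ) (a : ℤ × ℤ × ℤ) : Prop :=
  memE N a ∧ IsCoprime (a.1 * a.2.1 * a.2.2) (N : ℤ)

def memE2 (N : ℕ) (a : ℤ × ℤ × ℤ) : Prop :=
  memE1 N a ∧ IsCoprime (a.1 - a.2.2) (N : ℤ) ∧ IsCoprime (a.1 + a.2.2) (N : ℤ) ∧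
    IsCoprime (a.2.1 - a.2.2) (N : ℤ) ∧ IsCoprime (a.2.1 + a.2.2) (N : ℤ)

/-- `M` is a lift to `Γ₀(N)` of `diag(λ⁻¹, λ)` for the class `s = λ ∈ 𝔖_N`. -/
def IsDiagLift (N : ℕ) (M : SL(2, ℤ)) (s : SNgroup N) : Prop :=
  ∃ u : (ZMod N)ˣ, (QuotientGroup.mk u : SNgroup N) = s ∧
    ((M 0 0 : ℤ) : ZMod N) = ((u⁻¹ : (ZMod N)ˣ) : ZMod N) ∧
    ((M 0 1 : ℤ) : ZMod N) = 0 ∧ ((M 1 0 : ℤ) : ZMod N) = 0 ∧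
    ((M 1 1 : ℤ) : ZMod N) = (u : ZMod N)

/-- The function `T_{𝔄,F}`. -/
noncomputable def Tfun (N : ℕ) {n : ℕ} (A : Fin n → ℤ × ℤ × ℤ)
    (F : MvPolynomial (Fin n) ℤ) (M : SNgroup N → SL(2, ℤ)) (τ : ℂ) : ℂ :=
  ∑ᶠ s : SNgroup N, MvPolynomial.aeval
    (fun i => Wfun N (A i).1 (A i).2.1 (A i).2.2 (moebius ((M s : SL(2, ℤ)) : Matrix (Fin 2) (Fin 2) ℤ) τ)) F

/-- The matrix `B(t,u,v,k)`. -/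
def Bmat (t : ℕ) (u v k : ℤ) : Matrix (Fin 2) (Fin 2) ℤ :=
  !![u, (u * v - 1) / (t : ℤ) + u * k; (t : ℤ), v + (t : ℤ) * k]

/-- `{a}` : the representative of `±a mod N` in `(0, N/2]` (paper's `{·}`). -/
def red (N : ℕ) (a : ℤ) : ℤ :=
  if 2 * (a % (N : ℤ)) ≤ (N : ℤ) then a % (N : ℤ) else (N : ℤ) - a % (N : ℤ)

/-- `μ(a) ∈ {±1}` with `a ≡ μ(a){a} mod N`. -/
def muSign (N : ℕ) (a : ℤ) : ℤ :=
  if 2 * (a % (N : ℤ)) ≤ (N : ℤ) then 1 else -1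

/-- `φ_s(τ) = (2πi)⁻²℘(s/N; L_τ) − 1/12`. -/
noncomputable def phiFun (N : ℕ) (s : ℤ) (τ : ℂ) : ℂ :=
  (1 / (2 * (Real.pi : ℂ) * Complex.I) ^ 2) * wp τ ((s : ℂ) / N) - 1 / 12

/-- `f[A]₂` : weight-2 slash of `φ_s`. -/
noncomputable def phiSlash (N : ℕ) (s : ℤ) (A : Matrix (Fin 2) (Fin 2) ℤ) (τ : ℂ) : ℂ :=
  phiFun N s (moebius A τ) * ((A 1 0 : ℂ) * τ + (A 1 1 : ℂ)) ^ (-2 : ℤ)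

/-- `q = e^{2πiτ/N}`. -/
noncomputable def qq (N : ℕ) (τ : ℂ) : ℂ :=
  Complex.exp (2 * (Real.pi : ℂ) * Complex.I * τ / N)

/-- `ζ = e^{2πi/N}`. -/
noncomputable def zetaN (N : ℕ) : ℂ :=
  Complex.exp (2 * (Real.pi : ℂ) * Complex.I / N)

/-- `θ_{a,b} = ζ^a(1−ζ^{b−a})(1−ζ^{b+a})/((1−ζ^a)²(1−ζ^b)²)`. -/
noncomputable def theta (ζ : ℂ) (a b : ℤ) : ℂ :=
  ζ ^ a * (1 - ζ ^ (b - a)) * (1 - ζ ^ (b + a)) / ((1 - ζ ^ a) ^ 2 * (1 - ζ ^ b) ^ 2)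

/-- The period pair `(1, τ)` for `τ` in the upper half-plane. -/
noncomputable def upperPeriodPair (τ : ℂ) (hτ : 0 < τ.im) : PeriodPair where
  ω₁ := 1
  ω₂ := τ
  indep := by
    rw [LinearIndependent.pair_iff]
    intro s t h
    have him := congrArg Complex.im h
    have hre := congrArg Complex.re h
    simp at him hre
    have ht : t = 0 := by
      rcases him with h | h
      · exact h
      · exact absurd h hτ.ne'
    subst ht
    simpa using hre

theorem wp_eq_tsum (τ : ℂ) (hτ : 0 < τ.im) (z : ℂ) :
    wp τ z = ∑' p : ℤ × ℤ, (1 / (z - ((p.1 : ℂ) + (p.2 : ℂ) * τ)) ^ 2 -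
      1 / ((p.1 : ℂ) + (p.2 : ℂ) * τ) ^ 2) := by
  let L := upperPeriodPair τ hτ
  have hs : Summable fun p : ℤ × ℤ => (1 / (z - ((p.1 : ℂ) + (p.2 : ℂ) * τ)) ^ 2 -
      1 / ((p.1 : ℂ) + (p.2 : ℂ) * τ) ^ 2) := by
    have h := (L.latticeEquivProd.symm.toEquiv.summable_iff).mpr (L.hasSum_weierstrassP z).summable
    refine h.congr fun p => ?_
    have hp : ((L.latticeEquivProd.symm p : L.lattice) : ℂ) = (p.1 : ℂ) + (p.2 : ℂ) * τ := by
      rw [L.latticeEquiv_symm_apply]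
      simp [L, upperPeriodPair]
    simp [hp]
  have hzero := hs.tsum_subtype_add_tsum_subtype_compl {0}
  have hsingle := tsum_singleton (0 : ℤ × ℤ) fun p =>
    (1 / (z - ((p.1 : ℂ) + (p.2 : ℂ) * τ)) ^ 2 - 1 / ((p.1 : ℂ) + (p.2 : ℂ) * τ) ^ 2)
  rw [← hzero, hsingle, wp]
  congr 1
  simp

theorem wp_eq_weierstrassP (τ : ℂ) (hτ : 0 < τ.im) (z : ℂ) :
    wp τ z = (upperPeriodPair τ hτ).weierstrassP z := by
  rw [wp_eq_tsum τ hτ, PeriodPair.weierstrassP,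
    ← (upperPeriodPair τ hτ).latticeEquivProd.symm.toEquiv.tsum_eq]
  refine tsum_congr fun p => ?_
  have hp : (((upperPeriodPair τ hτ).latticeEquivProd.symm p :
      (upperPeriodPair τ hτ).lattice) : ℂ) = (p.1 : ℂ) + (p.2 : ℂ) * τ := by
    rw [PeriodPair.latticeEquiv_symm_apply]
    simp [upperPeriodPair]
  simp [hp]

theorem wp_neg (τ : ℂ) (hτ : 0 < τ.im) (z : ℂ) : wp τ (-z) = wp τ z := by
  simp [wp_eq_weierstrassP τ hτ]

theorem wp_add_lattice (τ : ℂ) (hτ : 0 < τ.im) (z : ℂ) (m n : ℤ) :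
    wp τ (z + (m + n * τ)) = wp τ z := by
  have hl : (m : ℂ) + n * τ ∈ (upperPeriodPair τ hτ).lattice :=
    PeriodPair.mem_lattice.mpr ⟨m, n, by simp [upperPeriodPair]⟩
  simpa [wp_eq_weierstrassP τ hτ] using
    (upperPeriodPair τ hτ).weierstrassP_add_coe z ⟨_, hl⟩

theorem denom_ne_zero_of_SL (γ : SL(2, ℤ)) (τ : ℂ) (hτ : 0 < τ.im) :
    (γ 1 0 : ℂ) * τ + (γ 1 1 : ℂ) ≠ 0 := by
  intro h
  have him := congrArg Complex.im h
  have hre := congrArg Complex.re h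
  simp [hτ.ne'] at him hre
  have hdet := Matrix.det_fin_two γ.1
  rw [γ.2] at hdet
  simp [him] at hre hdet
  simp [hre] at hdet

theorem moebius_im_pos (γ : SL(2, ℤ)) (τ : ℂ) (hτ : 0 < τ.im) :
    0 < (moebius (γ : Matrix (Fin 2) (Fin 2) ℤ) τ).im := by
  have h := (γ • (⟨τ, hτ⟩ : UpperHalfPlane)).im_pos
  have he : ((γ • (⟨τ, hτ⟩ : UpperHalfPlane) : UpperHalfPlane) : ℂ) =
      moebius (γ : Matrix (Fin 2) (Fin 2) ℤ) τ := by
    rw [UpperHalfPlane.specialLinearGroup_apply]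
    simp [moebius]
  rw [← he]
  exact h

/-- The action of `SL(2, ℤ)` on the coordinates of lattice points. -/
def latticeCoordEquiv (γ : SL(2, ℤ)) : ℤ × ℤ ≃ ℤ × ℤ where
  toFun p := (p.1 * γ 1 1 + p.2 * γ 0 1, p.1 * γ 1 0 + p.2 * γ 0 0)
  invFun p := (p.1 * γ 0 0 - p.2 * γ 0 1, p.2 * γ 1 1 - p.1 * γ 1 0)
  left_inv p := by
    have hdet : γ 0 0 * γ 1 1 - γ 0 1 * γ 1 0 = 1 := by
      rw [← Matrix.det_fin_two, γ.2]
    ext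
    · linear_combination p.1 * hdet
    · linear_combination p.2 * hdet
  right_inv p := by
    have hdet : γ 0 0 * γ 1 1 - γ 0 1 * γ 1 0 = 1 := by
      rw [← Matrix.det_fin_two, γ.2]
    ext
    · linear_combination p.1 * hdet
    · linear_combination p.2 * hdet

/-- Homogeneity of `℘` under a modular change of lattice basis. -/
theorem wp_moebius (γ : SL(2, ℤ)) (τ : ℂ) (hτ : 0 < τ.im) (z : ℂ) :
    wp (moebius (γ : Matrix (Fin 2) (Fin 2) ℤ) τ) z =
      ((γ 1 0 : ℂ) * τ + (γ 1 1 : ℂ)) ^ 2 * wp τ (((γ 1 0 : ℂ) * τ + (γ 1 1 : ℂ)) * z) := by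
  have hj := denom_ne_zero_of_SL γ τ hτ
  rw [wp_eq_tsum _ (moebius_im_pos γ τ hτ), wp_eq_tsum τ hτ, ← tsum_mul_left]
  symm
  rw [← (latticeCoordEquiv γ).tsum_eq]
  symm
  refine tsum_congr fun p => ?_
  set j := (γ 1 0 : ℂ) * τ + (γ 1 1 : ℂ) with hjdef
  have hl : (((latticeCoordEquiv γ p).1 : ℤ) : ℂ) + (((latticeCoordEquiv γ p).2 : ℤ) : ℂ) * τ =
      j * ((p.1 : ℂ) + (p.2 : ℂ) * moebius (γ : Matrix (Fin 2) (Fin 2) ℤ) τ) := by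
    have hm : j * moebius (γ : Matrix (Fin 2) (Fin 2) ℤ) τ = (γ 0 0 : ℂ) * τ + (γ 0 1 : ℂ) :=
      mul_div_cancel₀ _ hj
    simp only [latticeCoordEquiv, Equiv.coe_fn_mk]
    push_cast
    linear_combination (p.1 : ℂ) * (-hjdef) - (p.2 : ℂ) * hm
  have hscale (x : ℂ) : j ^ 2 * (1 / (j * x) ^ 2) = 1 / x ^ 2 := by
    rw [mul_pow, ← div_div, mul_div_assoc', mul_one_div_cancel (pow_ne_zero 2 hj)]
  rw [hl, ← mul_sub j, mul_sub (j ^ 2), hscale, hscale]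

theorem wp_div_eq_of_dvd_sub (N : ℕ) (hN : 0 < N) (τ : ℂ) (hτ : 0 < τ.im) {a b : ℤ}
    (h : (N : ℤ) ∣ a - b) : wp τ ((a : ℂ) / N) = wp τ ((b : ℂ) / N) := by
  obtain ⟨k, hk⟩ := h
  have hN' : (N : ℂ) ≠ 0 := Nat.cast_ne_zero.mpr hN.ne'
  have ha : (a : ℂ) = b + N * k := by
    have : a = b + N * k := by linarith
    exact_mod_cast this
  rw [← wp_add_lattice τ hτ ((b : ℂ) / N) k 0]
  congr 1
  rw [ha]
  field_simp
  simp

theorem wp_div_eq_of_dvd_add (N : ℕ) (hN : 0 < N) (τ : ℂ) (hτ : 0 < τ.im) {a b : ℤ}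
    (h : (N : ℤ) ∣ a + b) : wp τ ((a : ℂ) / N) = wp τ ((b : ℂ) / N) := by
  rw [← wp_neg τ hτ ((b : ℂ) / N), ← neg_div, ← Int.cast_neg]
  exact wp_div_eq_of_dvd_sub N hN τ hτ (by simpa using h)

theorem wp_red (N : ℕ) (hN : 0 < N) (τ : ℂ) (hτ : 0 < τ.im) (a : ℤ) :
    wp τ ((red N a : ℂ) / N) = wp τ ((a : ℂ) / N) := by
  have h := Int.emod_add_mul_ediv a N
  rw [red]
  split_ifs
  · exact wp_div_eq_of_dvd_sub N hN τ hτ ⟨-(a / N), by linarith⟩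
  · exact wp_div_eq_of_dvd_add N hN τ hτ ⟨1 + a / N, by linarith⟩

/-- Two units with the same image modulo `±1` agree up to sign. -/
theorem eq_or_eq_neg_of_mk_eq {N : ℕ} {u v : (ZMod N)ˣ}
    (h : (QuotientGroup.mk u : SNgroup N) = QuotientGroup.mk v) : v = u ∨ v = -u := by
  rw [QuotientGroup.eq, ← Subgroup.zpowers_eq_closure, Subgroup.mem_zpowers_iff] at h
  obtain ⟨k, hk⟩ := h
  have hv : v = u * (-1) ^ k := by rw [hk, mul_inv_cancel_left]
  rcases Int.even_or_odd k with hk | hk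
  · left
    simpa [hk.neg_one_zpow] using hv
  · right
    simpa [hk.neg_one_zpow] using hv

theorem wp_moebius_div (N : ℕ) (hN : 0 < N) (γ : SL(2, ℤ)) (s : SNgroup N)
    (hγ : IsDiagLift N γ s) (r : ℤ)
    (hr : ∃ u : (ZMod N)ˣ, (QuotientGroup.mk u : SNgroup N) = s ∧ (r : ZMod N) = (u : ZMod N))
    (τ : ℂ) (hτ : 0 < τ.im) (a : ℤ) :
    wp (moebius (γ : Matrix (Fin 2) (Fin 2) ℤ) τ) ((a : ℂ) / N) =
      ((γ 1 0 : ℂ) * τ + (γ 1 1 : ℂ)) ^ 2 * wp τ ((red N (r * a) : ℂ) / N) := by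
  obtain ⟨u, hu, -, -, hc, hd⟩ := hγ
  obtain ⟨v, hv, hrv⟩ := hr
  have hN' : (N : ℂ) ≠ 0 := Nat.cast_ne_zero.mpr hN.ne'
  obtain ⟨k, hk⟩ := (ZMod.intCast_zmod_eq_zero_iff_dvd (γ 1 0) N).mp hc
  rw [wp_moebius γ τ hτ, wp_red N hN τ hτ]
  congr 1
  have hz : ((γ 1 0 : ℂ) * τ + (γ 1 1 : ℂ)) * ((a : ℂ) / N) =
      ((γ 1 1 * a : ℤ) : ℂ) / N + (((0 : ℤ) : ℂ) + ((k * a : ℤ) : ℂ) * τ) := by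
    rw [hk]
    push_cast
    field_simp
    ring
  rw [hz, wp_add_lattice τ hτ]
  rcases eq_or_eq_neg_of_mk_eq (hu.trans hv.symm) with rfl | rfl
  · apply wp_div_eq_of_dvd_sub N hN τ hτ
    rw [← ZMod.intCast_zmod_eq_zero_iff_dvd]
    push_cast
    rw [hd, hrv, sub_self]
  · apply wp_div_eq_of_dvd_add N hN τ hτ
    rw [← ZMod.intCast_zmod_eq_zero_iff_dvd]
    push_cast
    rw [hd, hrv, Units.val_neg]
    ring

theorem Wfun_moebius (N : ℕ) (hN : 0 < N) (γ : SL(2, ℤ)) (s : SNgroup N)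
    (hγ : IsDiagLift N γ s) (r : ℤ)
    (hr : ∃ u : (ZMod N)ˣ, (QuotientGroup.mk u : SNgroup N) = s ∧ (r : ZMod N) = (u : ZMod N))
    (τ : ℂ) (hτ : 0 < τ.im) (a₁ a₂ a₃ : ℤ) :
    Wfun N a₁ a₂ a₃ (moebius (γ : Matrix (Fin 2) (Fin 2) ℤ) τ) =
      Wfun N (red N (r * a₁)) (red N (r * a₂)) (red N (r * a₃)) τ := by
  simp only [Wfun, wp_moebius_div N hN γ s hγ r hr τ hτ, ← mul_sub]
  exact mul_div_mul_left _ _ (pow_ne_zero 2 (denom_ne_zero_of_SL γ τ hτ))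

/-- `T_{𝔄,F}(τ) = Σ_{λ∈𝔖_N} F(W_{λ𝔞₁}(τ),…,W_{λ𝔞ₙ}(τ))`; in particular
`T_{𝔄,F}` is independent of the choice of the matrices `M_λ`. Here `R s` is an integer
representative of the class `s = λ ∈ 𝔖_N`. -/
theorem stmt7 (N : ℕ) (hN : 0 < N) {n : ℕ} (A : Fin n → ℤ × ℤ × ℤ)
    (hA : ∀ i, memE N (A i)) (F : MvPolynomial (Fin n) ℤ)
    (M : SNgroup N → SL(2, ℤ))
    (hM : ∀ s, M s ∈ CongruenceSubgroup.Gamma0 N ∧ IsDiagLift N (M s) s)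
    (R : SNgroup N → ℤ)
    (hR : ∀ s, ∃ u : (ZMod N)ˣ, (QuotientGroup.mk u : SNgroup N) = s ∧
        ((R s : ℤ) : ZMod N) = (u : ZMod N))
    (τ : ℂ) (hτ : 0 < τ.im) :
    Tfun N A F M τ = ∑ᶠ s : SNgroup N, MvPolynomial.aeval
      (fun i => Wfun N (red N (R s * (A i).1)) (red N (R s * (A i).2.1))
        (red N (R s * (A i).2.2)) τ) F := by
  refine finsum_congr fun s => ?_
  simp only [Wfun_moebius N hN (M s) s (hM s).2 (R s) (hR s) τ hτ]
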